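/- Let γ → δ be a frank right action by a letter c with bumped letter b. Then in ℤStyl(A): b e_γ c = b c e_δ. -/

import Mathlib

noncomputable section

open FreeMonoid

/-- The defining relations of the stylic congruence: the Knuth (plactic)
relations together with the idempotent relations `a² ≡ a`. -/
inductive StylicRel (A : Type*) [LinearOrder A] : FreeMonoid A → FreeMonoid A → Prop
  | knuth1 {a b c : A} : a < b → b < c →
      StylicRel A (ofList [b, a, c]) (ofList [b, c, a])
  | knuth2 {a b c : A} : a < b → b < c →
      StylicRel A (ofList [a, c, b]) (ofList [c, a, b])
  | knuth3 {a b : A} : a < b →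
      StylicRel A (ofList [b, a, b]) (ofList [b, b, a])
  | knuth4 {a b : A} : a < b →
      StylicRel A (ofList [a, b, a]) (ofList [b, a, a])
  | idem (a : A) : StylicRel A (ofList [a, a]) (ofList [a])

/-- The stylic congruence on the free monoid `A*`. -/
def stylCon (A : Type*) [LinearOrder A] : Con (FreeMonoid A) := conGen (StylicRel A)

/-- The stylic monoid `Styl(A)`. -/
abbrev Styl (A : Type*) [LinearOrder A] := (stylCon A).Quotient

/-- The image of a letter `a` in the stylic algebra `ℤStyl(A)`. -/
def styGen {A : Type*} [LinearOrder A] (a : A) : MonoidAlgebra ℤ (Styl A) :=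
  MonoidAlgebra.of ℤ (Styl A) ((stylCon A).mk' (FreeMonoid.of a))

/-- The idempotent `e_γ = (∏_{a∉γ}^{↗} (1-a)) · (∏_{a∈γ}^{↘} a)` of `ℤStyl(A)`
associated with a column (subset) `γ ⊆ A`. -/
def eIdem {A : Type*} [LinearOrder A] [Fintype A] (γ : Finset A) :
    MonoidAlgebra ℤ (Styl A) :=
  (((γᶜ).sort (· ≤ ·)).map (fun a => 1 - styGen a)).prod *
    ((γ.sort (· ≤ ·)).reverse.map styGen).prod

/-- Right action of a letter `c` on a column `γ`: if `c < min γ` then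
`γ ∪ {c}`; otherwise replace `max {x ∈ γ : x ≤ c}` (the bumped letter) by `c`. -/
def rIns {A : Type*} [LinearOrder A] (γ : Finset A) (c : A) : Finset A :=
  if h : (γ.filter (· ≤ c)).Nonempty then
    insert c (γ.erase ((γ.filter (· ≤ c)).max' h))
  else insert c γ

/-- Schensted left column insertion of a letter `b` into a column `δ`:
if `b > max δ` then `δ ∪ {b}`; otherwise replace `min {x ∈ δ : x ≥ b}`
(the bumped letter) by `b`. -/
def lIns {A : Type*} [LinearOrder A] (b : A) (δ : Finset A) : Finset A :=
  if h : (δ.filter (b ≤ ·)).Nonempty then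
    insert b (δ.erase ((δ.filter (b ≤ ·)).min' h))
  else insert b δ

/-- The right action of a word on a column, `γ·(uv) = (γ·u)·v`. -/
def rActW {A : Type*} [LinearOrder A] (γ : Finset A) (w : List A) : Finset A :=
  w.foldl rIns γ

/-- The left action of a word on a column, `(uv)·γ = u·(v·γ)`. -/
def lActW {A : Type*} [LinearOrder A] (w : List A) (γ : Finset A) : Finset A :=
  w.foldr lIns γ

section Helpers

theorem core_identity {R : Type*} [Ring R] (b c U N W V : R)
    (bb : b * b = b) (bcb : b * c * b = c * b)
    (hUb : b * U * b = b * U) (hUc : b * U * c = b * c * U) (hVc : b * V * c = b * c * V)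
    (hW1 : c * W * c = W * c) (hW2 : W * b * c = b * W * c)
    (hN1 : N * ((1 - c) * (W * b * c)) = (1 - c) * (W * b * c))
    (hN2 : (b * c - c * b) * N = b * c - c * b) :
    b * (U * N * (1 - c) * W * b * V) * c = b * c * (U * (1 - b) * N * W * c * V) := by
  have key : b * (1 - c) * (b * W * c) = (b * c - c * b) * W * c := by
    calc b * (1 - c) * (b * W * c) = (b * b) * W * c - (b * c * b) * W * c := by noncomm_ring
      _ = b * (W * c) - c * b * W * c := by rw [bb, bcb]; noncomm_ring
      _ = b * (c * W * c) - c * b * W * c := by rw [hW1]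
      _ = _ := by noncomm_ring
  calc b * (U * N * (1 - c) * W * b * V) * c
      = (b * U) * N * (1 - c) * W * (b * V * c) := by noncomm_ring
    _ = (b * U * b) * N * (1 - c) * W * (b * c * V) := by rw [hUb, hVc]
    _ = (b * U) * b * (N * ((1 - c) * (W * b * c))) * V := by noncomm_ring
    _ = (b * U) * (b * (1 - c) * (b * W * c)) * V := by rw [hN1, hW2]; noncomm_ring
    _ = (b * U) * ((b * c - c * b) * N * W * c) * V := by rw [key, hN2]
    _ = (b * U) * ((b * c - b * c * b) * N * W * c) * V := by rw [bcb]
    _ = (b * U * b) * c * (1 - b) * N * W * c * V := by noncomm_ring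
    _ = (b * U * c) * (1 - b) * N * W * c * V := by rw [hUb]
    _ = _ := by rw [hUc]; noncomm_ring

variable {A : Type*} [LinearOrder A]

theorem styGen_rel3 {a b c a' b' c' : A}
    (h : StylicRel A (ofList [a, b, c]) (ofList [a', b', c'])) :
    styGen a * styGen b * styGen c = styGen a' * styGen b' * styGen c' := by
  have h1 : (stylCon A).mk' (ofList [a, b, c]) = (stylCon A).mk' (ofList [a', b', c']) :=
    (Con.eq _).2 (ConGen.Rel.of _ _ h)
  simp only [styGen, ← map_mul]
  exact congrArg _ h1

theorem gen_idem (a : A) : styGen a * styGen a = styGen a := by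
  have h1 : (stylCon A).mk' (ofList [a, a]) = (stylCon A).mk' (ofList [a]) :=
    (Con.eq _).2 (ConGen.Rel.of _ _ (StylicRel.idem a))
  simp only [styGen, ← map_mul]
  exact congrArg _ h1

theorem gen_bab {a b : A} (h : a < b) :
    styGen b * styGen a * styGen b = styGen b * styGen a := by
  rw [styGen_rel3 (StylicRel.knuth3 h), gen_idem]

theorem gen_aba {a b : A} (h : a < b) :
    styGen a * styGen b * styGen a = styGen b * styGen a := by
  rw [styGen_rel3 (StylicRel.knuth4 h), mul_assoc, gen_idem]

/-- Left absorption and commutation. -/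
theorem low_lemma {b c : A} (hbc : b < c) {U : MonoidAlgebra ℤ (Styl A)}
    (hU : U ∈ Algebra.adjoin ℤ (styGen '' {x : A | x < b})) :
    styGen b * U * styGen b = styGen b * U ∧
      styGen b * U * styGen c = styGen b * styGen c * U := by
  induction hU using Algebra.adjoin_induction with
  | mem x hx =>
    obtain ⟨a, ha, rfl⟩ := hx
    exact ⟨gen_bab ha, styGen_rel3 (StylicRel.knuth1 ha hbc)⟩
  | algebraMap r =>
    constructor
    · rw [mul_assoc, Algebra.commutes, ← mul_assoc, gen_idem]
    · rw [mul_assoc, Algebra.commutes, ← mul_assoc]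
  | add x y _ _ hx hy =>
    simp only [mul_add, add_mul, hx.1, hx.2, hy.1, hy.2, and_self]
  | mul x y _ _ hx hy =>
    constructor
    · calc styGen b * (x * y) * styGen b
          = (styGen b * x) * y * styGen b := by simp only [mul_assoc]
        _ = (styGen b * x * styGen b) * y * styGen b := by rw [hx.1]
        _ = styGen b * x * (styGen b * y * styGen b) := by simp only [mul_assoc]
        _ = (styGen b * x * styGen b) * y := by rw [hy.1]; simp only [mul_assoc]
        _ = _ := by rw [hx.1]; simp only [mul_assoc]
    · calc styGen b * (x * y) * styGen c
          = (styGen b * x) * y * styGen c := by simp only [mul_assoc]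
        _ = (styGen b * x * styGen b) * y * styGen c := by rw [hx.1]
        _ = styGen b * x * (styGen b * y * styGen c) := by simp only [mul_assoc]
        _ = (styGen b * x * styGen b) * styGen c * y := by rw [hy.2]; simp only [mul_assoc]
        _ = _ := by rw [hx.1, hx.2]; simp only [mul_assoc]

/-- Right absorption and commutation. -/
theorem high_lemma {b c : A} (hbc : b < c) {W : MonoidAlgebra ℤ (Styl A)}
    (hW : W ∈ Algebra.adjoin ℤ (styGen '' {x : A | c < x})) :
    styGen c * W * styGen c = W * styGen c ∧
      W * styGen b * styGen c = styGen b * W * styGen c := by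
  induction hW using Algebra.adjoin_induction with
  | mem x hx =>
    obtain ⟨a, ha, rfl⟩ := hx
    exact ⟨gen_aba ha, (styGen_rel3 (StylicRel.knuth2 hbc ha)).symm⟩
  | algebraMap r =>
    constructor
    · rw [← Algebra.commutes, mul_assoc, gen_idem]
    · rw [Algebra.commutes]
  | add x y _ _ hx hy =>
    simp only [mul_add, add_mul, hx.1, hx.2, hy.1, hy.2, and_self]
  | mul x y _ _ hx hy =>
    constructor
    · calc styGen c * (x * y) * styGen c
          = (styGen c * x) * (y * styGen c) := by simp only [mul_assoc]
        _ = (styGen c * x) * (styGen c * y * styGen c) := by rw [hy.1]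
        _ = (styGen c * x * styGen c) * (y * styGen c) := by simp only [mul_assoc]
        _ = x * (styGen c * y * styGen c) := by rw [hx.1]; simp only [mul_assoc]
        _ = _ := by rw [hy.1]; simp only [mul_assoc]
    · calc x * y * styGen b * styGen c
          = x * (y * styGen b * styGen c) := by simp only [mul_assoc]
        _ = x * styGen b * (y * styGen c) := by rw [hy.2]; simp only [mul_assoc]
        _ = x * styGen b * (styGen c * y * styGen c) := by rw [hy.1]
        _ = (x * styGen b * styGen c) * (y * styGen c) := by simp only [mul_assoc]
        _ = styGen b * x * (styGen c * y * styGen c) := by rw [hx.2]; simp only [mul_assoc]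
        _ = _ := by rw [hy.1]; simp only [mul_assoc]

theorem mid_left {b c : A} (hbc : b < c) {W : MonoidAlgebra ℤ (Styl A)}
    (hW : W ∈ Algebra.adjoin ℤ (styGen '' {x : A | c < x}))
    (l : List A) (hl : ∀ m ∈ l, b < m ∧ m < c) :
    (l.map (fun a => 1 - styGen a)).prod * ((1 - styGen c) * (W * styGen b * styGen c)) =
      (1 - styGen c) * (W * styGen b * styGen c) := by
  induction l with
  | nil => simp
  | cons m l ih =>
    have hm := hl m (by simp)
    rw [List.map_cons, List.prod_cons, mul_assoc, ih (fun x hx => hl x (by simp [hx]))]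
    obtain ⟨h1, h2⟩ := high_lemma hbc hW
    have h3 := styGen_rel3 (StylicRel.knuth1 hm.1 hm.2)
    have : styGen m * (W * styGen b * styGen c) =
        styGen m * styGen c * (W * styGen b * styGen c) := by
      calc styGen m * (W * styGen b * styGen c)
          = styGen m * styGen b * (W * styGen c) := by rw [h2]; simp only [mul_assoc]
        _ = styGen m * styGen b * styGen c * (W * styGen c) := by
            rw [← h1]; simp only [mul_assoc]; rw [← mul_assoc (styGen c) (styGen c), gen_idem]
        _ = styGen m * styGen c * (styGen b * W * styGen c) := by rw [h3]; simp only [mul_assoc]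
        _ = _ := by rw [h2]
    have h0 : styGen m * ((1 - styGen c) * (W * styGen b * styGen c)) = 0 := by
      rw [sub_mul, one_mul, mul_sub, this, mul_assoc, sub_self]
    rw [sub_mul, one_mul, h0, sub_zero]

theorem mid_right {b c : A}
    (l : List A) (hl : ∀ m ∈ l, b < m ∧ m < c) :
    (styGen b * styGen c - styGen c * styGen b) * (l.map (fun a => 1 - styGen a)).prod =
      styGen b * styGen c - styGen c * styGen b := by
  induction l with
  | nil => simp
  | cons m l ih =>
    have hm := hl m (by simp)
    rw [List.map_cons, List.prod_cons, ← mul_assoc, mul_sub, mul_one, sub_mul _ _ (styGen m),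
      styGen_rel3 (StylicRel.knuth2 hm.1 hm.2), sub_self, sub_zero,
      ih (fun x hx => hl x (by simp [hx]))]

theorem sort_union_lt (s t : Finset A) (h : ∀ x ∈ s, ∀ y ∈ t, x < y) :
    (s ∪ t).sort (· ≤ ·) = s.sort (· ≤ ·) ++ t.sort (· ≤ ·) := by
  have hn : (s.sort (· ≤ ·) ++ t.sort (· ≤ ·)).Nodup := by
    rw [List.nodup_append]
    refine ⟨Finset.sort_nodup _ _, Finset.sort_nodup _ _, ?_⟩
    intro x hx y hy
    exact (h x ((Finset.mem_sort _).1 hx) y ((Finset.mem_sort _).1 hy)).ne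
  have hp : (s.sort (· ≤ ·) ++ t.sort (· ≤ ·)).Pairwise (· ≤ ·) := by
    rw [List.pairwise_append]
    refine ⟨Finset.pairwise_sort _ _, Finset.pairwise_sort _ _, ?_⟩
    intro x hx y hy
    exact (h x ((Finset.mem_sort _).1 hx) y ((Finset.mem_sort _).1 hy)).le
  have := (List.toFinset_sort (· ≤ ·) hn).2 hp
  rwa [List.toFinset_append, Finset.sort_toFinset, Finset.sort_toFinset] at this

/-- Three-part splitting of the sorted list of a finset at a member. -/
theorem sort_split (s : Finset A) (c : A) (hc : c ∈ s) :
    s.sort (· ≤ ·) = (s.filter (· < c)).sort (· ≤ ·) ++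
      (c :: (s.filter (c < ·)).sort (· ≤ ·)) := by
  have h2 : ({c} ∪ s.filter (c < ·)).sort (· ≤ ·) = c :: (s.filter (c < ·)).sort (· ≤ ·) := by
    rw [sort_union_lt _ _ (by simp), Finset.sort_singleton]; rfl
  rw [← h2, ← sort_union_lt]
  · congr 1
    ext x
    simp only [Finset.mem_union, Finset.mem_filter, Finset.mem_singleton]
    rcases lt_trichotomy x c with h | h | h
    · simp [h, h.not_gt, h.ne]
    · simp [h, hc]
    · simp [h, h.not_gt, h.ne']
  · intro x hx y hy
    simp only [Finset.mem_union, Finset.mem_filter, Finset.mem_singleton] at hx hy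
    rcases hy with rfl | hy
    · exact hx.2
    · exact hx.2.trans hy.2

theorem prod_mem_adjoin {S : Set A} (l : List A) (hl : ∀ x ∈ l, x ∈ S) :
    (l.map styGen).prod ∈ Algebra.adjoin ℤ (styGen '' S) := by
  apply Subalgebra.list_prod_mem
  intro x hx
  obtain ⟨a, ha, rfl⟩ := List.mem_map.1 hx
  exact Algebra.subset_adjoin ⟨a, hl a ha, rfl⟩

theorem prod_one_sub_mem_adjoin {S : Set A} (l : List A) (hl : ∀ x ∈ l, x ∈ S) :
    (l.map (fun a => 1 - styGen a)).prod ∈ Algebra.adjoin ℤ (styGen '' S) := by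
  apply Subalgebra.list_prod_mem
  intro x hx
  obtain ⟨a, ha, rfl⟩ := List.mem_map.1 hx
  exact sub_mem (one_mem _) (Algebra.subset_adjoin ⟨a, hl a ha, rfl⟩)

end Helpers

/-- Lemma `identity`, first identity: if `γ → δ` is a
frank right action by `c` with bumped letter `b`, then `b e_γ c = b c e_δ`
in `ℤStyl(A)`. -/
theorem eIdem_edge_left {A : Type*} [LinearOrder A] [Fintype A]
    (γ : Finset A) (c : A) (hcγ : c ∉ γ)
    (hfil : (γ.filter (· ≤ c)).Nonempty)
    (b : A) (hb : b = (γ.filter (· ≤ c)).max' hfil)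
    (δ : Finset A) (hδ : δ = insert c (γ.erase b)) :
    styGen b * eIdem γ * styGen c = styGen b * styGen c * eIdem δ := by
  have hbmem : b ∈ γ.filter (· ≤ c) := hb ▸ Finset.max'_mem _ hfil
  have hbγ : b ∈ γ := (Finset.mem_filter.1 hbmem).1
  have hbc : b < c := lt_of_le_of_ne (Finset.mem_filter.1 hbmem).2
    (fun h => hcγ (h ▸ hbγ))
  have hmax : ∀ x ∈ γ, x ≤ c → x ≤ b := fun x hx hxc => by
    rw [hb]; exact Finset.le_max' _ _ (Finset.mem_filter.2 ⟨hx, hxc⟩)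
  -- the blocks
  set L' := (γᶜ.filter (· < b)).sort (· ≤ ·) with hL'
  set M := (γᶜ.filter (fun x => b < x ∧ x < c)).sort (· ≤ ·) with hM
  set H' := (γᶜ.filter (c < ·)).sort (· ≤ ·) with hH'
  set L := (γ.filter (· < b)).sort (· ≤ ·) with hL
  set H := (γ.filter (c < ·)).sort (· ≤ ·) with hH
  have e1 : γᶜ.sort (· ≤ ·) = (L' ++ M) ++ c :: H' := by
    rw [sort_split γᶜ c (by simpa using hcγ), hL', hM, ← sort_union_lt]
    · congr 2
      ext x
      simp only [Finset.mem_union, Finset.mem_filter, Finset.mem_compl]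
      grind
    · intro x hx y hy
      exact (Finset.mem_filter.1 hx).2.trans (Finset.mem_filter.1 hy).2.1
  have e2 : γ.sort (· ≤ ·) = L ++ b :: H := by
    rw [sort_split γ b hbγ]
    congr 3
    ext x
    simp only [Finset.mem_filter]
    grind
  have e3 : δᶜ.sort (· ≤ ·) = L' ++ b :: (M ++ H') := by
    rw [sort_split δᶜ b (by simp [hδ, hbc.ne]), hH', hM, ← sort_union_lt]
    · refine congrArg₂ (fun (s t : Finset A) => s.sort (· ≤ ·) ++ b :: t.sort (· ≤ ·)) ?_ ?_
      · ext x
        simp only [Finset.mem_filter, Finset.mem_compl, hδ, Finset.mem_insert, Finset.mem_erase]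
        grind
      · ext x
        simp only [Finset.mem_union, Finset.mem_filter, Finset.mem_compl, hδ, Finset.mem_insert,
          Finset.mem_erase]
        grind
    · intro x hx y hy
      exact (Finset.mem_filter.1 hx).2.2.trans (Finset.mem_filter.1 hy).2
  have e4 : δ.sort (· ≤ ·) = L ++ c :: H := by
    rw [sort_split δ c (by simp [hδ])]
    refine congrArg₂ (fun (s t : Finset A) => s.sort (· ≤ ·) ++ c :: t.sort (· ≤ ·)) ?_ ?_
    · ext x
      simp only [Finset.mem_filter, hδ, Finset.mem_insert, Finset.mem_erase]
      grind
    · ext x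
      simp only [Finset.mem_filter, hδ, Finset.mem_insert, Finset.mem_erase]
      grind
  have hU := low_lemma hbc (prod_one_sub_mem_adjoin (S := {x | x < b}) L'
    (fun x hx => (Finset.mem_filter.1 ((Finset.mem_sort _).1 hx)).2))
  have hV := low_lemma hbc (prod_mem_adjoin (S := {x | x < b}) L.reverse
    (fun x hx => (Finset.mem_filter.1 ((Finset.mem_sort _).1 (List.mem_reverse.1 hx))).2))
  have hWm := mul_mem (prod_one_sub_mem_adjoin (S := {x | c < x}) H'
    (fun x hx => (Finset.mem_filter.1 ((Finset.mem_sort _).1 hx)).2))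
    (prod_mem_adjoin (S := {x | c < x}) H.reverse
    (fun x hx => (Finset.mem_filter.1 ((Finset.mem_sort _).1 (List.mem_reverse.1 hx))).2))
  have hW := high_lemma hbc hWm
  have hMm : ∀ m ∈ M, b < m ∧ m < c :=
    fun x hx => (Finset.mem_filter.1 ((Finset.mem_sort _).1 hx)).2
  have main := core_identity _ _ _ _ _ _ (gen_idem b) (gen_aba hbc) hU.1 hU.2 hV.2 hW.1 hW.2
    (mid_left hbc hWm M hMm) (mid_right M hMm)
  unfold eIdem
  rw [e1, e2, e3, e4]
  simp only [List.map_append, List.map_cons, List.prod_append, List.prod_cons,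
    List.reverse_append, List.reverse_cons, List.map_nil, List.prod_nil, mul_one, one_mul,
    mul_assoc] at main ⊢
  exact main
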